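/- arXiv:2309.00785 — 3 statements merged into one kernel-verified Lean document; each statement's English description precedes it below -/
import Mathlib

section
/- Let M_V be an invertible symmetric N×N real matrix, M_E an invertible M×M real matrix, F an N×M real matrix, B ∈ ℝ^N, R ∈ ℝ^M, Δt ∈ ℝ, and 𝟙 ∈ ℝ^M the vector of all ones. Given a state (v⁰, e⁰) ∈ ℝ^N × ℝ^M, define the RK2-average full step v¹ = v⁰ − Δt · M_V⁻¹ (F 𝟙 − B), v̄ = (v⁰ + v¹)/2, e¹ = e⁰ + Δt · M_E⁻¹ (Fᵀ v̄ + R). Then the discrete total energy E(v, e) = ½ vᵀ M_V v + 𝟙ᵀ M_E e satisfies E(v¹, e¹) − E(v⁰, e⁰) = Δt (B · v̄ + 𝟙 · R). -/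
open Matrix

/-- Fully discrete total energy balance of the RK2-average scheme:
`E(v¹,e¹) − E(v⁰,e⁰) = Δt (B · v̄ + 𝟙 · R)` where `E(v,e) = ½ vᵀ M_V v + 𝟙ᵀ M_E e`. -/
theorem rk2_total_energy_balance
    (N M : ℕ) (hN : 0 < N) (hM : 0 < M)
    (MV : Matrix (Fin N) (Fin N) ℝ) (hMV : IsUnit MV) (hMVsymm : MVᵀ = MV)
    (ME : Matrix (Fin M) (Fin M) ℝ) (hME : IsUnit ME)
    (F : Matrix (Fin N) (Fin M) ℝ) (B : Fin N → ℝ) (R : Fin M → ℝ) (Δt : ℝ)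
    (v₀ v₁ vbar : Fin N → ℝ) (e₀ e₁ : Fin M → ℝ)
    (hv₁ : v₁ = v₀ - Δt • (MV⁻¹ *ᵥ ((F *ᵥ fun _ => (1 : ℝ)) - B)))
    (hvbar : vbar = (1 / 2 : ℝ) • (v₀ + v₁))
    (he₁ : e₁ = e₀ + Δt • (ME⁻¹ *ᵥ (Fᵀ *ᵥ vbar + R))) :
    ((1 / 2 : ℝ) * (v₁ ⬝ᵥ (MV *ᵥ v₁)) + (fun _ => (1 : ℝ)) ⬝ᵥ (ME *ᵥ e₁)) -
        ((1 / 2 : ℝ) * (v₀ ⬝ᵥ (MV *ᵥ v₀)) + (fun _ => (1 : ℝ)) ⬝ᵥ (ME *ᵥ e₀)) =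
      Δt * (B ⬝ᵥ vbar + (fun _ => (1 : ℝ)) ⬝ᵥ R) := by
  have hV : MV *ᵥ v₁ = MV *ᵥ v₀ - Δt • ((F *ᵥ fun _ => (1 : ℝ)) - B) := by
    rw [hv₁, mulVec_sub, mulVec_smul, mulVec_mulVec,
      mul_nonsing_inv _ ((isUnit_iff_isUnit_det _).mp hMV), one_mulVec]
  have hE : ME *ᵥ e₁ = ME *ᵥ e₀ + Δt • (Fᵀ *ᵥ vbar + R) := by
    rw [he₁, mulVec_add, mulVec_smul, mulVec_mulVec,
      mul_nonsing_inv _ ((isUnit_iff_isUnit_det _).mp hME), one_mulVec]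
  have hsymm : v₁ ⬝ᵥ (MV *ᵥ v₀) = v₀ ⬝ᵥ (MV *ᵥ v₁) := by
    rw [dotProduct_mulVec, ← mulVec_transpose, hMVsymm, dotProduct_comm]
  have hwork : (fun _ => (1 : ℝ)) ⬝ᵥ (Fᵀ *ᵥ vbar) = vbar ⬝ᵥ (F *ᵥ fun _ => (1 : ℝ)) := by
    rw [mulVec_transpose, dotProduct_comm, dotProduct_mulVec]
  have hself : v₁ ⬝ᵥ (MV *ᵥ v₁) =
      v₁ ⬝ᵥ (MV *ᵥ v₀) - Δt * (v₁ ⬝ᵥ (F *ᵥ fun _ => (1 : ℝ)) - v₁ ⬝ᵥ B) := by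
    rw [hV, dotProduct_sub, dotProduct_smul, dotProduct_sub, smul_eq_mul]
  have hcross : v₀ ⬝ᵥ (MV *ᵥ v₁) =
      v₀ ⬝ᵥ (MV *ᵥ v₀) - Δt * (v₀ ⬝ᵥ (F *ᵥ fun _ => (1 : ℝ)) - v₀ ⬝ᵥ B) := by
    rw [hV, dotProduct_sub, dotProduct_smul, dotProduct_sub, smul_eq_mul]
  rw [hE, dotProduct_add, dotProduct_smul, dotProduct_add, hwork, hself, hsymm, hcross,
    dotProduct_comm B, hvbar]
  simp only [smul_dotProduct, add_dotProduct, smul_eq_mul]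
  ring
end

section
/- Let M_V be an invertible symmetric N×N real matrix, M_E an invertible M×M real matrix, and 𝟙 ∈ ℝ^M the vector of all ones. Let (Δtₙ)ₙ be real numbers and (Fₙ)ₙ be N×M real matrices, and let sequences (vₙ)ₙ in ℝ^N and (eₙ)ₙ in ℝ^M be defined recursively by vₙ₊₁ = vₙ − Δtₙ · M_V⁻¹ (Fₙ 𝟙) and eₙ₊₁ = eₙ + Δtₙ · M_E⁻¹ (Fₙᵀ ((vₙ + vₙ₊₁)/2)). Then the discrete total energy is conserved exactly at every step: for every n, ½ vₙᵀ M_V vₙ + 𝟙ᵀ M_E eₙ = ½ v₀ᵀ M_V v₀ + 𝟙ᵀ M_E e₀. -/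
open Matrix

/-- Polarization of the quadratic form of a symmetric matrix: a difference of two squares. -/
theorem dotProduct_mulVec_self_sub_of_transpose_eq {n R : Type*} [Fintype n] [CommRing R]
    {A : Matrix n n R} (hA : Aᵀ = A) (x y : n → R) :
    y ⬝ᵥ (A *ᵥ y) - x ⬝ᵥ (A *ᵥ x) = (x + y) ⬝ᵥ (A *ᵥ (y - x)) := by
  have h : y ⬝ᵥ (A *ᵥ x) = x ⬝ᵥ (A *ᵥ y) := by
    rw [dotProduct_mulVec, ← mulVec_transpose, hA, dotProduct_comm]
  rw [mulVec_sub, dotProduct_sub, add_dotProduct, add_dotProduct, h]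
  ring

/-- The RK2-average scheme with no body forces, sources or heat flux conserves the
discrete total energy `½ vₙᵀ M_V vₙ + 𝟙ᵀ M_E eₙ` exactly at every step. -/
theorem rk2_total_energy_conservation_all_steps
    (N M : ℕ) (hN : 0 < N) (hM : 0 < M)
    (MV : Matrix (Fin N) (Fin N) ℝ) (hMV : IsUnit MV) (hMVsymm : MVᵀ = MV)
    (ME : Matrix (Fin M) (Fin M) ℝ) (hME : IsUnit ME)
    (Δt : ℕ → ℝ) (F : ℕ → Matrix (Fin N) (Fin M) ℝ)
    (v : ℕ → Fin N → ℝ) (e : ℕ → Fin M → ℝ)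
    (hv : ∀ n, v (n + 1) = v n - Δt n • (MV⁻¹ *ᵥ (F n *ᵥ fun _ => (1 : ℝ))))
    (he : ∀ n, e (n + 1) =
      e n + Δt n • (ME⁻¹ *ᵥ ((F n)ᵀ *ᵥ ((1 / 2 : ℝ) • (v n + v (n + 1)))))) :
    ∀ n, (1 / 2 : ℝ) * (v n ⬝ᵥ (MV *ᵥ v n)) + (fun _ => (1 : ℝ)) ⬝ᵥ (ME *ᵥ e n) =
      (1 / 2 : ℝ) * (v 0 ⬝ᵥ (MV *ᵥ v 0)) + (fun _ => (1 : ℝ)) ⬝ᵥ (ME *ᵥ e 0) := by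
  intro n
  induction n with
  | zero => rfl
  | succ n ih =>
    rw [← ih]
    have hMV' : IsUnit MV.det := (isUnit_iff_isUnit_det MV).mp hMV
    have hME' : IsUnit ME.det := (isUnit_iff_isUnit_det ME).mp hME
    have momentum : MV *ᵥ (v (n + 1) - v n) = -(Δt n • (F n *ᵥ fun _ => (1 : ℝ))) := by
      rw [hv n, sub_sub_cancel_left, mulVec_neg, mulVec_smul, mulVec_mulVec,
        mul_nonsing_inv _ hMV', one_mulVec]
    have internal : ME *ᵥ e (n + 1) =
        ME *ᵥ e n + Δt n • ((F n)ᵀ *ᵥ ((1 / 2 : ℝ) • (v n + v (n + 1)))) := by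
      rw [he n, mulVec_add, mulVec_smul, mulVec_mulVec, mul_nonsing_inv _ hME', one_mulVec]
    have work : (fun _ => (1 : ℝ)) ⬝ᵥ ((F n)ᵀ *ᵥ (v n + v (n + 1))) =
        (v n + v (n + 1)) ⬝ᵥ (F n *ᵥ fun _ => (1 : ℝ)) := by
      rw [dotProduct_mulVec, vecMul_transpose, dotProduct_comm]
    have kinetic := dotProduct_mulVec_self_sub_of_transpose_eq hMVsymm (v n) (v (n + 1))
    rw [momentum, dotProduct_neg, dotProduct_smul, smul_eq_mul] at kinetic
    rw [internal, dotProduct_add, dotProduct_smul, mulVec_smul, dotProduct_smul, work,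
      smul_eq_mul, smul_eq_mul]
    linear_combination (1 / 2 : ℝ) * kinetic
end

section
/- Let M_V be a symmetric N×N real matrix and M_E an M×M real matrix (both constant in time), and let 𝟙 ∈ ℝ^M be the vector of all ones. Let v : ℝ → ℝ^N and e : ℝ → ℝ^M, and at a time t suppose v has derivative v′ and e has derivative e′ satisfying the semi-discrete equations M_V v′ = −F 𝟙 + B and M_E e′ = Fᵀ v(t) + R, where F is an N×M real matrix, B ∈ ℝ^N and R ∈ ℝ^M. Then the discrete total energy function s ↦ ½ v(s)ᵀ M_V v(s) + 𝟙ᵀ M_E e(s) is differentiable at t with derivative v(t) · B + 𝟙 · R. -/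
open Matrix

/-- Product rule for the dot product of differentiable real vector-valued functions. -/
theorem HasDerivAt.dotProduct {n : Type*} [Fintype n] {f g : ℝ → n → ℝ} {f' g' : n → ℝ} {t : ℝ}
    (hf : HasDerivAt f f' t) (hg : HasDerivAt g g' t) :
    HasDerivAt (fun s => f s ⬝ᵥ g s) (f' ⬝ᵥ g t + f t ⬝ᵥ g') t := by
  simp only [_root_.dotProduct, ← Finset.sum_add_distrib]
  exact HasDerivAt.fun_sum fun i _ => (hasDerivAt_pi.1 hf i).mul (hasDerivAt_pi.1 hg i)

/-- A constant matrix commutes with differentiation of a vector-valued function. -/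
theorem HasDerivAt.const_mulVec {m n : Type*} [Fintype m] [Fintype n] (A : Matrix m n ℝ)
    {f : ℝ → n → ℝ} {f' : n → ℝ} {t : ℝ} (hf : HasDerivAt f f' t) :
    HasDerivAt (fun s => A *ᵥ f s) (A *ᵥ f') t :=
  A.mulVecLin.toContinuousLinearMap.hasFDerivAt.comp_hasDerivAt t hf

/-- Semi-discrete total energy identity: if `M_V v′ = −F 𝟙 + B` and `M_E e′ = Fᵀ v(t) + R`,
then the discrete total energy `s ↦ ½ v(s)ᵀ M_V v(s) + 𝟙ᵀ M_E e(s)` is differentiable at `t`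
with derivative `v(t) · B + 𝟙 · R`. -/
theorem semidiscrete_total_energy_derivative
    (N M : ℕ) (hN : 0 < N) (hM : 0 < M)
    (MV : Matrix (Fin N) (Fin N) ℝ) (hMVsymm : MVᵀ = MV)
    (ME : Matrix (Fin M) (Fin M) ℝ)
    (F : Matrix (Fin N) (Fin M) ℝ) (B : Fin N → ℝ) (R : Fin M → ℝ)
    (v : ℝ → Fin N → ℝ) (e : ℝ → Fin M → ℝ)
    (v' : Fin N → ℝ) (e' : Fin M → ℝ) (t : ℝ)
    (hv : HasDerivAt v v' t) (he : HasDerivAt e e' t)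
    (hmom : MV *ᵥ v' = -(F *ᵥ fun _ => (1 : ℝ)) + B)
    (hene : ME *ᵥ e' = Fᵀ *ᵥ v t + R) :
    HasDerivAt
      (fun s => (1 / 2 : ℝ) * (v s ⬝ᵥ (MV *ᵥ v s)) + (fun _ => (1 : ℝ)) ⬝ᵥ (ME *ᵥ e s))
      (v t ⬝ᵥ B + (fun _ => (1 : ℝ)) ⬝ᵥ R) t := by
  have hsymm : v' ⬝ᵥ (MV *ᵥ v t) = v t ⬝ᵥ (MV *ᵥ v') := by
    rw [dotProduct_mulVec, ← mulVec_transpose, hMVsymm, dotProduct_comm]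
  have hwork : (fun _ => (1 : ℝ)) ⬝ᵥ (Fᵀ *ᵥ v t) = v t ⬝ᵥ (F *ᵥ fun _ => (1 : ℝ)) := by
    rw [mulVec_transpose, dotProduct_comm, dotProduct_mulVec]
  refine (((hv.dotProduct (hv.const_mulVec MV)).const_mul (1 / 2 : ℝ)).add
    ((hasDerivAt_const t fun _ => (1 : ℝ)).dotProduct (he.const_mulVec ME))).congr_deriv ?_
  rw [hsymm, hmom, hene, dotProduct_add, dotProduct_add, dotProduct_neg, hwork, zero_dotProduct]
  ring
end
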